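/- If M and N are models of T_MSO(Fin), then M ⊗ N is a model of T_MSO(Fin). -/

import Mathlib

open FirstOrder FirstOrder.Language

namespace MSO

/-! ### The language `L_⊗` and its semantics -/

/-- The language `L_⊗`: a constant `⊥`, a unary relation `At`,
and two binary relations: `⊆` (encoded `true`) and `≤ᴱ` (encoded `false`). -/
def Lmso : Language where
  Functions := fun n => match n with | 0 => Unit | _ => Empty
  Relations := fun n => match n with | 1 => Unit | 2 => Bool | _ => Empty

/-- The constant symbol `⊥`. -/
def botC : Lmso.Constants := Unit.unit
/-- The unary relation symbol `At`. -/
def atR : Lmso.Relations 1 := Unit.unit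
/-- The binary relation symbol `⊆`. -/
def subR : Lmso.Relations 2 := true
/-- The binary relation symbol `≤ᴱ`. -/
def exleR : Lmso.Relations 2 := false

/-- The interpretation of `⊥` in an `L_⊗`-structure. -/
def botE (M : Type*) [Lmso.Structure M] : M := Structure.funMap botC ![]
/-- The interpretation of `At` in an `L_⊗`-structure. -/
def atE {M : Type*} [Lmso.Structure M] (a : M) : Prop := Structure.RelMap atR ![a]
/-- The interpretation of `⊆` in an `L_⊗`-structure. -/
def subE {M : Type*} [Lmso.Structure M] (a b : M) : Prop := Structure.RelMap subR ![a, b]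
/-- The interpretation of `≤ᴱ` in an `L_⊗`-structure. -/
def exleE {M : Type*} [Lmso.Structure M] (a b : M) : Prop := Structure.RelMap exleR ![a, b]

/-- The monadic second order version `M̃SO(α)` of a linear order `α`, as an `L_⊗`-structure:
the universe is the powerset of `α`, `⊆` is inclusion, `⊥` is `∅`, `At` holds of singletons,
and `A ≤ᴱ B` iff there are `a ∈ A` and `b ∈ B` with `a < b`. -/
instance msoStructure (α : Type*) [LinearOrder α] : Lmso.Structure (Set α) where
  funMap := fun {n} f _ => match n, f with
    | 0, _ => (∅ : Set α)
  RelMap := fun {n} r v => match n, r with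
    | 1, _ => ∃ a : α, v 0 = {a}
    | 2, true => v 0 ⊆ v 1
    | 2, false => ∃ a ∈ v 0, ∃ b ∈ v 1, a < b

/-- `MSO(n)`, the monadic second order version of the `n`-element linear order. -/
abbrev MSOn (n : ℕ) : Type := Set (Fin n)

/-- The operation `⊗` on `L_⊗`-structures: the universe is the product, `⊆` is componentwise,
`⊥` is the pair of bottoms, `At` holds of the atoms (minimal non-bottom elements) of the
resulting order, and `(A,B) ≤ᴱ (C,D)` iff (`A ≠ ⊥` and `D ≠ ⊥`), or `A ≤ᴱ C`, or `B ≤ᴱ D`. -/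
instance tensorStructure (M N : Type*) [Lmso.Structure M] [Lmso.Structure N] :
    Lmso.Structure (M × N) where
  funMap := fun {n} f _ => match n, f with
    | 0, _ => (botE M, botE N)
  RelMap := fun {n} r v => match n, r with
    | 1, _ => v 0 ≠ (botE M, botE N) ∧
        ∀ q : M × N, subE q.1 (v 0).1 → subE q.2 (v 0).2 →
          q = (botE M, botE N) ∨ q = v 0
    | 2, true => subE (v 0).1 (v 1).1 ∧ subE (v 0).2 (v 1).2
    | 2, false => ((v 0).1 ≠ botE M ∧ (v 1).2 ≠ botE N) ∨
        exleE (v 0).1 (v 1).1 ∨ exleE (v 0).2 (v 1).2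

/-! ### Formulas -/

/-- Bounded `L_⊗`-formulas with no free (outer) variables. -/
abbrev BF (n : ℕ) := Lmso.BoundedFormula Empty n

/-- The `i`-th de Bruijn variable as a term. -/
def tv {n : ℕ} (i : Fin n) : Lmso.Term (Empty ⊕ Fin n) := Term.var (Sum.inr i)
/-- The constant `⊥` as a term. -/
def tb {n : ℕ} : Lmso.Term (Empty ⊕ Fin n) := Constants.term botC

def sub' {n : ℕ} (i j : Fin n) : BF n := subR.boundedFormula₂ (tv i) (tv j)
def exle' {n : ℕ} (i j : Fin n) : BF n := exleR.boundedFormula₂ (tv i) (tv j)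
def at' {n : ℕ} (i : Fin n) : BF n := atR.boundedFormula₁ (tv i)
def eq' {n : ℕ} (i j : Fin n) : BF n := Term.bdEqual (tv i) (tv j)
def isBot' {n : ℕ} (i : Fin n) : BF n := Term.bdEqual (tv i) tb
def botSub' {n : ℕ} (i : Fin n) : BF n := subR.boundedFormula₂ tb (tv i)

/-- Finite conjunction. -/
def bigAnd {n : ℕ} (l : List (BF n)) : BF n := l.foldr (· ⊓ ·) ⊤
/-- Finite disjunction. -/
def bigOr {n : ℕ} (l : List (BF n)) : BF n := l.foldr (· ⊔ ·) ⊥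

/-- `k` is the meet of `i` and `j` (with respect to `⊆`). -/
def isMeet {n : ℕ} (k i j : Fin n) : BF n :=
  sub' k i ⊓ sub' k j ⊓
    ∀' ((sub' (Fin.last n) i.castSucc ⊓ sub' (Fin.last n) j.castSucc) ⟹
      sub' (Fin.last n) k.castSucc)

/-- `k` is the join of `i` and `j` (with respect to `⊆`). -/
def isJoin {n : ℕ} (k i j : Fin n) : BF n :=
  sub' i k ⊓ sub' j k ⊓
    ∀' ((sub' i.castSucc (Fin.last n) ⊓ sub' j.castSucc (Fin.last n)) ⟹
      sub' k.castSucc (Fin.last n))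

/-- The meet of `i` and `j` is `⊥`. -/
def meetIsBot {n : ℕ} (i j : Fin n) : BF n :=
  ∀' ((sub' (Fin.last n) i.castSucc ⊓ sub' (Fin.last n) j.castSucc) ⟹ isBot' (Fin.last n))

/-- The join of `i` and `j` is the top element. -/
def joinIsTop {n : ℕ} (i j : Fin n) : BF n :=
  ∀' ((sub' i.castSucc (Fin.last n) ⊓ sub' j.castSucc (Fin.last n)) ⟹
    ∀' (sub' (Fin.last (n + 1)) ((Fin.last n).castSucc)))

/-- `j` is a (Boolean) complement of `i`. -/
def isComplOf {n : ℕ} (j i : Fin n) : BF n := meetIsBot i j ⊓ joinIsTop i j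

/-- `i` is an atom: non-bottom, and minimal among non-bottom elements. -/
def isAtomDef {n : ℕ} (i : Fin n) : BF n :=
  ∼(isBot' i) ⊓
    ∀' (sub' (Fin.last n) i.castSucc ⟹ (isBot' (Fin.last n) ⊔ eq' (Fin.last n) i.castSucc))

/-! ### The base theory `T_base` -/

def axRefl : Lmso.Sentence := ∀' sub' 0 0
def axAntisymm : Lmso.Sentence := ∀' ∀' ((sub' 0 1 ⊓ sub' 1 0) ⟹ eq' 0 1)
def axTrans : Lmso.Sentence := ∀' ∀' ∀' ((sub' 0 1 ⊓ sub' 1 2) ⟹ sub' 0 2)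
def axBotLe : Lmso.Sentence := ∀' botSub' 0
def axTop : Lmso.Sentence := ∃' ∀' (sub' 1 0)
def axMeet : Lmso.Sentence := ∀' ∀' ∃' (isMeet 2 0 1)
def axJoin : Lmso.Sentence := ∀' ∀' ∃' (isJoin 2 0 1)
def axCompl : Lmso.Sentence := ∀' ∃' (isComplOf 1 0)
def axDistrib : Lmso.Sentence :=
  ∀' ∀' ∀' ∀' ∀' ∀' ∀' ∀'
    ((isMeet 3 0 1 ⊓ isMeet 4 0 2 ⊓ isJoin 5 1 2 ⊓ isMeet 6 0 5 ⊓ isJoin 7 3 4) ⟹ sub' 6 7)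
def axAt : Lmso.Sentence := ∀' (at' 0 ⇔ isAtomDef 0)
def axAtomic : Lmso.Sentence := ∀' (∼(isBot' 0) ⟹ ∃' (at' 1 ⊓ sub' 1 0))
def axIrrefl : Lmso.Sentence := ∀' (at' 0 ⟹ ∼(exle' 0 0))
def axTransAt : Lmso.Sentence :=
  ∀' ∀' ∀' ((at' 0 ⊓ at' 1 ⊓ at' 2 ⊓ exle' 0 1 ⊓ exle' 1 2) ⟹ exle' 0 2)
def axTrich : Lmso.Sentence :=
  ∀' ∀' ((at' 0 ⊓ at' 1) ⟹ (exle' 0 1 ⊔ eq' 0 1 ⊔ exle' 1 0))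
def axExleDef : Lmso.Sentence :=
  ∀' ∀' (exle' 0 1 ⇔ ∃' ∃' (at' 2 ⊓ at' 3 ⊓ sub' 2 0 ⊓ sub' 3 1 ⊓ exle' 2 3))

/-- The comprehension axiom for a formula `η(x; Y₁,…,Yₙ)` (with `x` the last variable):
`∀ Ȳ ∃ X ∀ x (At x → (x ⊆ X ↔ η(x; Ȳ)))`. -/
def compAx {n : ℕ} (η : BF (n + 1)) : Lmso.Sentence :=
  BoundedFormula.alls (∃' ∀' (at' (Fin.last (n + 1)) ⟹
    (sub' (Fin.last (n + 1)) ((Fin.last n).castSucc) ⇔ η.liftAt 1 n)))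

/-- The base theory `T_base`: an atomic Boolean algebra under `⊆` with bottom `⊥`, `At`
holding exactly of the atoms, `≤ᴱ` linearly ordering the atoms and determined by its
restriction to the atoms, together with the comprehension scheme. -/
def Tbase : Lmso.Theory :=
  {axRefl, axAntisymm, axTrans, axBotLe, axTop, axMeet, axJoin, axCompl, axDistrib,
    axAt, axAtomic, axIrrefl, axTransAt, axTrich, axExleDef} ∪
  ⋃ n : ℕ, Set.range (compAx (n := n))

/-! ### The theory `T_MSO(Fin)` -/

/-- `i` is the `≤ᴱ`-least atom. -/
def isLeastAtom {n : ℕ} (i : Fin n) : BF n :=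
  at' i ⊓ ∀' (at' (Fin.last n) ⟹ ∼(exle' (Fin.last n) i.castSucc))

/-- `i` is the `≤ᴱ`-greatest atom. -/
def isGreatestAtom {n : ℕ} (i : Fin n) : BF n :=
  at' i ⊓ ∀' (at' (Fin.last n) ⟹ ∼(exle' i.castSucc (Fin.last n)))

/-- `j` is the immediate `≤ᴱ`-successor of the atom `i`. -/
def isSuccOf {n : ℕ} (j i : Fin n) : BF n :=
  at' i ⊓ at' j ⊓ exle' i j ⊓
    ∀' ((at' (Fin.last n) ⊓ exle' i.castSucc (Fin.last n)) ⟹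
      (eq' (Fin.last n) j.castSucc ⊔ exle' j.castSucc (Fin.last n)))

def axLeastAtom : Lmso.Sentence := (∃' at' 0) ⟹ ∃' isLeastAtom 0
def axGreatestAtom : Lmso.Sentence := (∃' at' 0) ⟹ ∃' isGreatestAtom 0
def axSucc : Lmso.Sentence :=
  ∀' ((at' 0 ⊓ ∃' (at' 1 ⊓ exle' 0 1)) ⟹ ∃' isSuccOf 1 0)
def axPred : Lmso.Sentence :=
  ∀' ((at' 0 ⊓ ∃' (at' 1 ⊓ exle' 1 0)) ⟹ ∃' isSuccOf 0 1)
def axLeastIn : Lmso.Sentence :=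
  ∀' (∼(isBot' 0) ⟹ ∃' (at' 1 ⊓ sub' 1 0 ⊓ ∀' ((at' 2 ⊓ sub' 2 0) ⟹ ∼(exle' 2 1))))

/-- The theory `T_MSO(Fin)`: `T_base` together with axioms saying that the ordering of the
atoms is discrete with endpoints, and every non-bottom element contains a least atom. -/
def TMSOFin : Lmso.Theory :=
  Tbase ∪ {axLeastAtom, axGreatestAtom, axSucc, axPred, axLeastIn}

/-! ### Quantifier rank, unnested formulas, and `≈ₖ` -/

/-- Quantifier rank of a bounded formula. -/
def qr : ∀ {n : ℕ}, BF n → ℕ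
  | _, BoundedFormula.falsum => 0
  | _, BoundedFormula.equal _ _ => 0
  | _, BoundedFormula.rel _ _ => 0
  | _, BoundedFormula.imp f g => max (qr f) (qr g)
  | _, BoundedFormula.all f => qr f + 1

/-- A formula is unnested if every atomic subformula is of one of the forms
`x = y`, `c = y`, or `R x̄` with the `xᵢ`, `y` variables (Hodges). -/
def IsUnnested : ∀ {n : ℕ}, BF n → Prop
  | _, BoundedFormula.falsum => True
  | _, BoundedFormula.equal s t =>
      (∃ i j, s = Term.var i ∧ t = Term.var j) ∨
      (∃ (c : Lmso.Constants) (j : _), s = Constants.term c ∧ t = Term.var j)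
  | _, BoundedFormula.rel _ ts => ∀ i, ∃ j, ts i = Term.var j
  | _, BoundedFormula.imp f g => IsUnnested f ∧ IsUnnested g
  | _, BoundedFormula.all f => IsUnnested f

/-- `M ≈ₖ N` : `M` and `N` satisfy the same unnested `L_⊗`-sentences of quantifier
rank at most `k`. -/
def EquivK (k : ℕ) (M N : Type*) [Lmso.Structure M] [Lmso.Structure N] : Prop :=
  ∀ φ : Lmso.Sentence, IsUnnested φ → qr φ ≤ k → (M ⊨ φ ↔ N ⊨ φ)

/-! ### The sentences `ρ_{d,h}`, `ψ_{>n}`, `ψ_{=n}` -/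

/-- The index (in `Fin d`) of `A_h` among `A₁, …, A_d`, identifying `h = 0` with `h = d`. -/
def aIdx (d h : ℕ) (hd : 0 < d) : Fin d := ⟨(h + d - 1) % d, Nat.mod_lt _ hd⟩

/-- The cyclic successor on the indices `{1, …, d}`. -/
def cyc {d : ℕ} (j : Fin d) : Fin d := ⟨((j : ℕ) + 1) % d, Nat.mod_lt _ j.pos⟩

/-- The sentence `ρ_{d,h}`: there is a partition of the atoms into `d` non-bottom elements
`A₁, …, A_d` such that the least atom is in `A₁`, the immediate successor of an atom lying in
`A_j` lies in `A_{j+1}` (cyclically), and the greatest atom is in `A_h`. -/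
def rho (d h : ℕ) : Lmso.Sentence :=
  if hd : 0 < d then
    BoundedFormula.exs (n := d) (
      -- each `A_i` is non-bottom
      bigAnd ((List.finRange d).map fun i => ∼(isBot' i)) ⊓
      -- every atom lies in some `A_i`
      (∀' (at' (Fin.last d) ⟹
        bigOr ((List.finRange d).map fun i => sub' (Fin.last d) i.castSucc))) ⊓
      -- the `A_i` are pairwise disjoint on atoms
      bigAnd ((List.finRange d).flatMap fun i => (List.finRange d).filterMap fun j =>
        if i.val < j.val then
          some (∀' (at' (Fin.last d) ⟹
            ∼(sub' (Fin.last d) i.castSucc ⊓ sub' (Fin.last d) j.castSucc)))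
        else none) ⊓
      -- the least atom lies in `A₁`
      (∀' (isLeastAtom (Fin.last d) ⟹ sub' (Fin.last d) ((aIdx d 1 hd).castSucc))) ⊓
      -- immediate successors move cyclically through the `A_j`
      bigAnd ((List.finRange d).map fun j =>
        ∀' ∀' ((sub' ((Fin.last d).castSucc) (j.castSucc.castSucc) ⊓
            isSuccOf (Fin.last (d + 1)) ((Fin.last d).castSucc)) ⟹
          sub' (Fin.last (d + 1)) ((cyc j).castSucc.castSucc))) ⊓
      -- the greatest atom lies in `A_h`
      (∀' (isGreatestAtom (Fin.last d) ⟹ sub' (Fin.last d) ((aIdx d h hd).castSucc))))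
  else ⊥

/-- The list of formulas `xᵢ ≠ xⱼ` for `i < j < n`. -/
def distinctPairs (n : ℕ) : List (BF n) :=
  (List.finRange n).flatMap fun i => (List.finRange n).filterMap fun j =>
    if i.val < j.val then some (∼(eq' i j)) else none

/-- `ψ_{>n}` : there exist at least `n + 1` distinct atoms. -/
def psiGt (n : ℕ) : Lmso.Sentence :=
  BoundedFormula.exs (n := n + 1)
    (bigAnd ((List.finRange (n + 1)).map fun i => at' i) ⊓ bigAnd (distinctPairs (n + 1)))

/-- `ψ_{=n}` : there exist exactly `n` distinct atoms. -/
def psiEq (n : ℕ) : Lmso.Sentence :=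
  BoundedFormula.exs (n := n)
    (bigAnd ((List.finRange n).map fun i => at' i) ⊓ bigAnd (distinctPairs n) ⊓
      ∀' (at' (Fin.last n) ⟹ bigOr ((List.finRange n).map fun i => eq' (Fin.last n) i.castSucc)))

/-! ### Residue functions and the theories `T_r̃` -/

/-- A residue function `ℙ × ℕ_{>0} → ℕ` (conditions imposed only at primes `p` and `j ≥ 1`):
`r(p,j) < p^j` and `r(p,j+1) ≡ r(p,j) [MOD p^j]`. -/
def IsResidueFunction (r : ℕ → ℕ → ℕ) : Prop :=
  ∀ p j : ℕ, p.Prime → 1 ≤ j → r p j < p ^ j ∧ r p (j + 1) ≡ r p j [MOD p ^ j]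

/-- A function `ℕ_{>1} → ℕ` is a residue function if it arises from a residue function
`ℙ × ℕ_{>0} → ℕ` as in the paper (conditions imposed only for `d > 1`). -/
def IsResidueFunctionTilde (rt : ℕ → ℕ) : Prop :=
  ∃ r : ℕ → ℕ → ℕ, IsResidueFunction r ∧
    ∀ d : ℕ, 1 < d → rt d < d ∧
      ∀ p j : ℕ, p.Prime → 1 ≤ j → p ^ j ∣ d → rt d ≡ r p j [MOD p ^ j]

/-- The theory `T_r̃ = T_MSO(Fin) ∪ {ψ_{>n} : n ∈ ℕ} ∪ {ρ_{d,r̃(d)} : d > 1}`. -/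
def Trt (rt : ℕ → ℕ) : Lmso.Theory :=
  TMSOFin ∪ Set.range psiGt ∪ {σ : Lmso.Sentence | ∃ d : ℕ, 1 < d ∧ σ = rho d (rt d)}

/-! ### Relativization and the sum of sentences -/

/-- Relativization of a formula to the elements `⊆ v`:
each quantifier `∀ Z (…)` becomes `∀ Z (Z ⊆ v → …)`. -/
def relv : ∀ {n : ℕ}, BF n → Fin n → BF n
  | _, BoundedFormula.falsum, _ => BoundedFormula.falsum
  | _, BoundedFormula.equal s t, _ => BoundedFormula.equal s t
  | _, BoundedFormula.rel r ts, _ => BoundedFormula.rel r ts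
  | _, BoundedFormula.imp f g, v => (relv f v).imp (relv g v)
  | n, BoundedFormula.all f, v =>
      BoundedFormula.all (sub' (Fin.last n) v.castSucc ⟹ relv f v.castSucc)

/-- `i` is downward closed with respect to the `≤ᴱ`-ordering of the atoms. -/
def dwcl' {n : ℕ} (i : Fin n) : BF n :=
  ∀' ∀' ((at' ((Fin.last n).castSucc) ⊓ at' (Fin.last (n + 1)) ⊓
      sub' ((Fin.last n).castSucc) (i.castSucc.castSucc) ⊓
      exle' (Fin.last (n + 1)) ((Fin.last n).castSucc)) ⟹
    sub' (Fin.last (n + 1)) (i.castSucc.castSucc))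

/-- The sentence `φ + ψ` : `∃ X (X downward closed ∧ φ^X ∧ ψ^(Xᶜ))`
(with the complement `Xᶜ` introduced by an existential quantifier). -/
def plusSent (φ ψ : Lmso.Sentence) : Lmso.Sentence :=
  ∃' ∃' (dwcl' (0 : Fin 2) ⊓ isComplOf (1 : Fin 2) (0 : Fin 2) ⊓
    relv (φ.liftAt 2 0) (0 : Fin 2) ⊓ relv (ψ.liftAt 2 0) (1 : Fin 2))

/-! ### `FSpec` and ultimate periodicity -/

/-- `FSpec φ` : the set of `n ∈ ℕ` such that `MSO(n) ⊨ φ`. -/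
def FSpec (φ : Lmso.Sentence) : Set ℕ := {n : ℕ | MSOn n ⊨ φ}

/-- A set of naturals is ultimately periodic. -/
def UltPeriodic (S : Set ℕ) : Prop :=
  ∃ N d : ℕ, 0 < d ∧ ∀ n : ℕ, N < n → (n ∈ S ↔ n + d ∈ S)

/-! ### The language `L_MO = {⊆, <}` -/

/-- The language `L_MO` with two binary relations: `⊆` (encoded `true`) and `<`
(encoded `false`). -/
def Lmo : Language where
  Functions := fun _ => Empty
  Relations := fun n => match n with | 2 => Bool | _ => Empty

/-- The monadic second order version `MSO(α)` of a linear order `α` as an `L_MO`-structure: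
`⊆` is inclusion and `<` is the ordering of `α` on singletons. -/
instance moStructure (α : Type*) [LinearOrder α] : Lmo.Structure (Set α) where
  funMap := fun f _ => f.elim
  RelMap := fun {n} r v => match n, r with
    | 2, true => v 0 ⊆ v 1
    | 2, false => ∃ a b : α, v 0 = {a} ∧ v 1 = {b} ∧ a < b

section Realize

variable {M : Type*} [Lmso.Structure M] {n : ℕ} {v : Empty → M} {xs : Fin n → M}

lemma realize_sub' {i j : Fin n} : (sub' i j).Realize v xs ↔ subE (xs i) (xs j) := by
  simp [sub', tv, subE]

lemma realize_exle' {i j : Fin n} : (exle' i j).Realize v xs ↔ exleE (xs i) (xs j) := by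
  simp [exle', tv, exleE]

lemma realize_at' {i : Fin n} : (at' i).Realize v xs ↔ atE (xs i) := by
  simp [at', tv, atE]

lemma realize_eq' {i j : Fin n} : (eq' i j).Realize v xs ↔ xs i = xs j := by
  simp [eq', tv]

lemma realize_tb {v : Empty ⊕ Fin n → M} : (tb (n := n)).realize v = botE M := by
  rw [tb, Term.realize_constants, botE]
  exact (funMap_eq_coe_constants).symm

lemma realize_isBot' {i : Fin n} : (isBot' i).Realize v xs ↔ xs i = botE M := by
  simp [isBot', tv, realize_tb]

lemma realize_botSub' {i : Fin n} : (botSub' i).Realize v xs ↔ subE (botE M) (xs i) := by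
  simp [botSub', tv, realize_tb, subE]

end Realize

/-- `k` is the greatest lower bound of `i` and `j`. -/
def IsMeetE {M : Type*} [Lmso.Structure M] (k i j : M) : Prop :=
  (subE k i ∧ subE k j) ∧ ∀ d, subE d i → subE d j → subE d k

/-- `k` is the least upper bound of `i` and `j`. -/
def IsJoinE {M : Type*} [Lmso.Structure M] (k i j : M) : Prop :=
  (subE i k ∧ subE j k) ∧ ∀ d, subE i d → subE j d → subE k d

/-- `j` is a complement of `i`. -/
def IsComplE {M : Type*} [Lmso.Structure M] (j i : M) : Prop :=
  (∀ d, subE d i → subE d j → d = botE M) ∧ ∀ d, subE i d → subE j d → ∀ e, subE e d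

/-- `j` is the immediate successor of the atom `i`. -/
def IsSuccE {M : Type*} [Lmso.Structure M] (j i : M) : Prop :=
  ((atE i ∧ atE j) ∧ exleE i j) ∧ ∀ k, atE k → exleE i k → k = j ∨ exleE j k

/-- Comprehension for definable (with parameters) sets of atoms. -/
def Comprehension (M : Type*) [Lmso.Structure M] : Prop :=
  ∀ (n : ℕ) (η : BF (n + 1)) (ys : Fin n → M),
    ∃ X : M, ∀ x, atE x → (subE x X ↔ η.Realize default (Fin.snoc ys x))

/-- The semantic content of `Tbase`. -/
structure IsBaseModel (M : Type*) [Lmso.Structure M] : Prop where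
  refl : ∀ a : M, subE a a
  antisymm : ∀ a b : M, subE a b → subE b a → a = b
  trans : ∀ a b c : M, subE a b → subE b c → subE a c
  bot_le : ∀ a : M, subE (botE M) a
  top : ∃ t : M, ∀ a, subE a t
  meet : ∀ a b : M, ∃ c, IsMeetE c a b
  join : ∀ a b : M, ∃ c, IsJoinE c a b
  compl : ∀ a : M, ∃ b, IsComplE b a
  distrib : ∀ a b c d e f g h : M, IsMeetE d a b → IsMeetE e a c → IsJoinE f b c →
    IsMeetE g a f → IsJoinE h d e → subE g h
  at_iff : ∀ a : M, atE a ↔ a ≠ botE M ∧ ∀ b, subE b a → b = botE M ∨ b = a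
  atomic : ∀ a : M, a ≠ botE M → ∃ b, atE b ∧ subE b a
  irrefl : ∀ a : M, atE a → ¬ exleE a a
  trans_at : ∀ a b c : M, atE a → atE b → atE c → exleE a b → exleE b c → exleE a c
  trich : ∀ a b : M, atE a → atE b → (exleE a b ∨ a = b) ∨ exleE b a
  exle_iff : ∀ a b : M, exleE a b ↔
    ∃ x y, (((atE x ∧ atE y) ∧ subE x a) ∧ subE y b) ∧ exleE x y
  comprehension : Comprehension M

/-- The semantic content of `TMSOFin`. -/
structure IsFinModel (M : Type*) [Lmso.Structure M] : Prop extends IsBaseModel M where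
  least : ∀ a : M, atE a → ∃ b : M, atE b ∧ ∀ c, atE c → ¬ exleE c b
  greatest : ∀ a : M, atE a → ∃ b : M, atE b ∧ ∀ c, atE c → ¬ exleE b c
  succ : ∀ a b : M, atE a → atE b → exleE a b → ∃ c, IsSuccE c a
  pred : ∀ a b : M, atE a → atE b → exleE b a → ∃ c, IsSuccE a c
  least_in : ∀ a : M, a ≠ botE M →
    ∃ b, (atE b ∧ subE b a) ∧ ∀ c, atE c → subE c a → ¬ exleE c b

section Realize

variable {M : Type*} [Lmso.Structure M]

lemma realize_isMeet {n : ℕ} {v : Empty → M} {xs : Fin n → M} {k i j : Fin n} :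
    (isMeet k i j).Realize v xs ↔ IsMeetE (xs k) (xs i) (xs j) := by
  simp [isMeet, IsMeetE, realize_sub']

lemma realize_isJoin {n : ℕ} {v : Empty → M} {xs : Fin n → M} {k i j : Fin n} :
    (isJoin k i j).Realize v xs ↔ IsJoinE (xs k) (xs i) (xs j) := by
  simp [isJoin, IsJoinE, realize_sub']

lemma realize_isComplOf {n : ℕ} {v : Empty → M} {xs : Fin n → M} {i j : Fin n} :
    (isComplOf j i).Realize v xs ↔ IsComplE (xs j) (xs i) := by
  simp [isComplOf, meetIsBot, joinIsTop, IsComplE, realize_sub', realize_isBot']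

lemma realize_isAtomDef {n : ℕ} {v : Empty → M} {xs : Fin n → M} {i : Fin n} :
    (isAtomDef i).Realize v xs ↔
      xs i ≠ botE M ∧ ∀ b, subE b (xs i) → b = botE M ∨ b = xs i := by
  simp [isAtomDef, realize_sub', realize_isBot', realize_eq']

lemma realize_isLeastAtom {n : ℕ} {v : Empty → M} {xs : Fin n → M} {i : Fin n} :
    (isLeastAtom i).Realize v xs ↔ atE (xs i) ∧ ∀ c, atE c → ¬ exleE c (xs i) := by
  simp [isLeastAtom, realize_at', realize_exle']

lemma realize_isGreatestAtom {n : ℕ} {v : Empty → M} {xs : Fin n → M} {i : Fin n} :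
    (isGreatestAtom i).Realize v xs ↔ atE (xs i) ∧ ∀ c, atE c → ¬ exleE (xs i) c := by
  simp [isGreatestAtom, realize_at', realize_exle']

lemma realize_isSuccOf {n : ℕ} {v : Empty → M} {xs : Fin n → M} {i j : Fin n} :
    (isSuccOf j i).Realize v xs ↔ IsSuccE (xs j) (xs i) := by
  simp [isSuccOf, IsSuccE, realize_at', realize_exle', realize_eq']

lemma realize_compAx {n : ℕ} (η : BF (n + 1)) :
    M ⊨ compAx η ↔ ∀ ys : Fin n → M,
      ∃ X : M, ∀ x, atE x → (subE x X ↔ η.Realize default (Fin.snoc ys x)) := by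
  rw [compAx, Sentence.Realize, BoundedFormula.realize_alls]
  refine forall_congr' fun ys => ?_
  simp only [BoundedFormula.realize_ex, BoundedFormula.realize_all, BoundedFormula.realize_imp,
    BoundedFormula.realize_iff, realize_at', realize_sub', Fin.snoc_last, Fin.snoc_castSucc]
  refine exists_congr fun X => forall_congr' fun x => imp_congr_right fun _ => ?_
  rw [BoundedFormula.realize_liftAt_one (Nat.le_succ n)]
  have : (Fin.snoc (Fin.snoc ys X : Fin (n + 1) → M) x : Fin (n + 1 + 1) → M) ∘
      (fun i : Fin (n + 1) => if (i : ℕ) < n then i.castSucc else i.succ) = Fin.snoc ys x := by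
    funext i
    refine Fin.lastCases ?_ (fun i => ?_) i
    · simp only [Function.comp_apply, Fin.val_last, lt_irrefl, if_false, Fin.succ_last,
        Fin.snoc_last]
    · simp
  rw [this]

lemma comprehension_iff : Comprehension M ↔ ∀ n, ∀ η : BF (n + 1), M ⊨ compAx η := by
  simp only [realize_compAx, Comprehension]

theorem model_TMSOFin_iff : M ⊨ TMSOFin ↔ IsFinModel M := by
  have hsnoc : ∀ {n : ℕ} (xs : Fin n → M) (a : M) (i : Fin (n + 1)),
      (Fin.snoc xs a : Fin (n + 1) → M) i = if h : (i : ℕ) < n then xs ⟨i, h⟩ else a :=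
    fun _ _ _ => rfl
  have key : M ⊨ TMSOFin ↔ ((M ⊨ axRefl ∧ M ⊨ axAntisymm ∧ M ⊨ axTrans ∧ M ⊨ axBotLe ∧
      M ⊨ axTop ∧ M ⊨ axMeet ∧ M ⊨ axJoin ∧ M ⊨ axCompl ∧ M ⊨ axDistrib ∧ M ⊨ axAt ∧
      M ⊨ axAtomic ∧ M ⊨ axIrrefl ∧ M ⊨ axTransAt ∧ M ⊨ axTrich ∧ M ⊨ axExleDef) ∧
      Comprehension M) ∧
      M ⊨ axLeastAtom ∧ M ⊨ axGreatestAtom ∧ M ⊨ axSucc ∧ M ⊨ axPred ∧ M ⊨ axLeastIn := by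
    rw [comprehension_iff]
    simp only [TMSOFin, Tbase, Theory.model_iff, Set.mem_union, or_imp, forall_and,
      Set.mem_insert_iff, Set.mem_singleton_iff, forall_eq, Set.mem_iUnion, Set.mem_range,
      forall_exists_index]
    simp only [forall_comm (α := Lmso.Sentence), forall_eq']
  rw [key]
  simp only [axRefl, axAntisymm, axTrans, axBotLe,
    axTop, axMeet, axJoin, axCompl, axDistrib, axAt, axAtomic, axIrrefl, axTransAt, axTrich,
    axExleDef, axLeastAtom, axGreatestAtom, axSucc, axPred, axLeastIn, Sentence.Realize,
    Formula.Realize, BoundedFormula.realize_all, BoundedFormula.realize_ex,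
    BoundedFormula.realize_imp, BoundedFormula.realize_inf, BoundedFormula.realize_sup,
    BoundedFormula.realize_not, BoundedFormula.realize_iff, realize_sub', realize_exle',
    realize_at', realize_eq', realize_isBot', realize_botSub', realize_isMeet, realize_isJoin,
    realize_isComplOf, realize_isAtomDef, realize_isLeastAtom, realize_isGreatestAtom,
    realize_isSuccOf, hsnoc]
  simp +decide only [dite_true, dite_false, and_imp]
  constructor
  · rintro ⟨⟨⟨h1, h2, h3, h4, h5, h6, h7, h8, h9, h10, h11, h12, h13, h14, h15⟩, hc⟩,
      h16, h17, h18, h19, h20⟩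
    exact { refl := h1, antisymm := h2, trans := h3, bot_le := h4, top := h5, meet := h6,
            join := h7, compl := h8, distrib := h9, at_iff := h10, atomic := h11, irrefl := h12,
            trans_at := h13, trich := h14, exle_iff := h15, comprehension := hc,
            least := fun a ha => h16 ⟨a, ha⟩, greatest := fun a ha => h17 ⟨a, ha⟩,
            succ := fun a b ha hb hab => h18 a ha ⟨b, hb, hab⟩,
            pred := fun a b ha hb hab => h19 a ha ⟨b, hb, hab⟩, least_in := h20 }
  · intro h
    exact ⟨⟨⟨h.refl, h.antisymm, h.trans, h.bot_le, h.top, h.meet, h.join, h.compl, h.distrib,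
      h.at_iff, h.atomic, h.irrefl, h.trans_at, h.trich, h.exle_iff⟩, h.comprehension⟩,
      fun ⟨a, ha⟩ => h.least a ha, fun ⟨a, ha⟩ => h.greatest a ha,
      fun a ha ⟨b, hb, hab⟩ => h.succ a b ha hb hab,
      fun a ha ⟨b, hb, hab⟩ => h.pred a b ha hb hab, h.least_in⟩

end Realize

lemma fst_snoc {M N : Type*} {n : ℕ} (xs : Fin n → M × N) (p : M × N) :
    (fun i => ((Fin.snoc xs p : Fin (n + 1) → M × N) i).1) =
      (Fin.snoc (fun i => (xs i).1) p.1 : Fin (n + 1) → M) := by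
  funext i
  refine Fin.lastCases ?_ (fun i => ?_) i <;> simp

lemma snd_snoc {M N : Type*} {n : ℕ} (xs : Fin n → M × N) (p : M × N) :
    (fun i => ((Fin.snoc xs p : Fin (n + 1) → M × N) i).2) =
      (Fin.snoc (fun i => (xs i).2) p.2 : Fin (n + 1) → N) := by
  funext i
  refine Fin.lastCases ?_ (fun i => ?_) i <;> simp

lemma term_realize_fst {M N : Type*} [Lmso.Structure M] [Lmso.Structure N]
    {n : ℕ} (t : Lmso.Term (Empty ⊕ Fin n)) (xs : Fin n → M × N) :
    (t.realize (Sum.elim default xs)).1 =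
      t.realize (Sum.elim default fun i => (xs i).1) := by
  match t with
  | .var (.inl e) => exact e.elim
  | .var (.inr i) => rfl
  | .func (l := 0) f ts =>
    change Structure.funMap botC _ = Structure.funMap f _
    exact congrArg₂ _ rfl (Subsingleton.elim _ _)
  | .func (l := k + 1) f ts => exact f.elim

lemma term_realize_snd {M N : Type*} [Lmso.Structure M] [Lmso.Structure N]
    {n : ℕ} (t : Lmso.Term (Empty ⊕ Fin n)) (xs : Fin n → M × N) :
    (t.realize (Sum.elim default xs)).2 =
      t.realize (Sum.elim default fun i => (xs i).2) := by
  match t with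
  | .var (.inl e) => exact e.elim
  | .var (.inr i) => rfl
  | .func (l := 0) f ts =>
    change Structure.funMap botC _ = Structure.funMap f _
    exact congrArg₂ _ rfl (Subsingleton.elim _ _)
  | .func (l := k + 1) f ts => exact f.elim

lemma subE_prod {M N : Type*} [Lmso.Structure M] [Lmso.Structure N] {p q : M × N} :
    subE p q ↔ subE p.1 q.1 ∧ subE p.2 q.2 := Iff.rfl

lemma exleE_prod {M N : Type*} [Lmso.Structure M] [Lmso.Structure N] {p q : M × N} :
    exleE p q ↔ (p.1 ≠ botE M ∧ q.2 ≠ botE N) ∨ exleE p.1 q.1 ∨ exleE p.2 q.2 := Iff.rfl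

lemma botE_prod {M N : Type*} [Lmso.Structure M] [Lmso.Structure N] :
    botE (M × N) = (botE M, botE N) := rfl

lemma atE_prod_iff {M N : Type*} [Lmso.Structure M] [Lmso.Structure N] {p : M × N} :
    atE p ↔ p ≠ botE (M × N) ∧ ∀ q, subE q p → q = botE (M × N) ∨ q = p := by
  simp only [subE_prod, and_imp]
  exact Iff.rfl

section Rectangular

variable {M N : Type*} [Lmso.Structure M] [Lmso.Structure N]

/-- Relations on `M × N` that are finite unions of products of a relation definable in `M` and
a relation definable in `N`. -/
inductive Rectangular (M N : Type*) [Lmso.Structure M] [Lmso.Structure N] {n : ℕ} :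
    ((Fin n → M × N) → Prop) → Prop
  | prod (α β : BF n) : Rectangular M N fun xs =>
      α.Realize default (fun i => (xs i).1) ∧ β.Realize default (fun i => (xs i).2)
  | or {P Q : (Fin n → M × N) → Prop} : Rectangular M N P → Rectangular M N Q →
      Rectangular M N fun xs => P xs ∨ Q xs

namespace Rectangular

variable {n : ℕ} {P Q : (Fin n → M × N) → Prop}

lemma congr (hP : Rectangular M N P) (h : ∀ xs, Q xs ↔ P xs) : Rectangular M N Q := by
  rwa [funext fun xs => propext (h xs)]

lemma left (α : BF n) : Rectangular M N fun xs : Fin n → M × N =>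
    α.Realize default fun i => (xs i).1 :=
  (prod α ⊤).congr fun xs => by simp

lemma right (β : BF n) : Rectangular M N fun xs : Fin n → M × N =>
    β.Realize default fun i => (xs i).2 :=
  (prod ⊤ β).congr fun xs => by simp

lemma and (hP : Rectangular M N P) (hQ : Rectangular M N Q) :
    Rectangular M N fun xs => P xs ∧ Q xs := by
  induction hP with
  | prod α β =>
    induction hQ with
    | prod γ δ => exact (prod (α ⊓ γ) (β ⊓ δ)).congr fun xs => by simp; tauto
    | or _ _ h₁ h₂ => exact (h₁.or h₂).congr fun xs => by tauto
  | or _ _ h₁ h₂ => exact (h₁.or h₂).congr fun xs => by tauto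

lemma not (hP : Rectangular M N P) : Rectangular M N fun xs => ¬ P xs := by
  induction hP with
  | prod α β => exact ((left (∼α)).or (right (∼β))).congr fun xs => by simp; tauto
  | or _ _ h₁ h₂ => exact (h₁.and h₂).congr fun xs => by tauto

lemma imp (hP : Rectangular M N P) (hQ : Rectangular M N Q) :
    Rectangular M N fun xs => P xs → Q xs :=
  (hP.not.or hQ).congr fun xs => by tauto

lemma ex {P : (Fin (n + 1) → M × N) → Prop} (hP : Rectangular M N P) :
    Rectangular M N fun xs => ∃ p, P (Fin.snoc xs p) := by
  induction hP with
  | prod α β =>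
    refine (prod (∃' α) (∃' β)).congr fun xs => ?_
    simp [fst_snoc, snd_snoc]
  | or _ _ h₁ h₂ => exact (h₁.or h₂).congr fun xs => exists_or

lemma all {P : (Fin (n + 1) → M × N) → Prop} (hP : Rectangular M N P) :
    Rectangular M N fun xs => ∀ p, P (Fin.snoc xs p) :=
  hP.not.ex.not.congr fun xs => by simp

end Rectangular

end Rectangular

namespace IsBaseModel

variable {M : Type*} [Lmso.Structure M]

lemma le_bot_iff (h : IsBaseModel M) {a : M} : subE a (botE M) ↔ a = botE M :=
  ⟨fun ha => h.antisymm _ _ ha (h.bot_le a), fun ha => ha ▸ h.refl _⟩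

lemma at_ne_bot (h : IsBaseModel M) {a : M} (ha : atE a) : a ≠ botE M :=
  ((h.at_iff a).1 ha).1

lemma not_at_bot (h : IsBaseModel M) : ¬ atE (botE M) := fun ha => h.at_ne_bot ha rfl

lemma not_exle_bot_left (h : IsBaseModel M) (a : M) : ¬ exleE (botE M) a := by
  rw [h.exle_iff]
  rintro ⟨x, y, ⟨⟨⟨hx, -⟩, hx'⟩, -⟩, -⟩
  exact h.at_ne_bot hx (h.le_bot_iff.1 hx')

lemma not_exle_bot_right (h : IsBaseModel M) (a : M) : ¬ exleE a (botE M) := by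
  rw [h.exle_iff]
  rintro ⟨x, y, ⟨⟨⟨-, hy⟩, -⟩, hy'⟩, -⟩
  exact h.at_ne_bot hy (h.le_bot_iff.1 hy')

end IsBaseModel

section Product

variable {M N : Type*} [Lmso.Structure M] [Lmso.Structure N]

lemma atE_prod (hM : IsBaseModel M) (hN : IsBaseModel N) (p : M × N) :
    atE p ↔ (atE p.1 ∧ p.2 = botE N) ∨ (p.1 = botE M ∧ atE p.2) := by
  obtain ⟨a, b⟩ := p
  rw [atE_prod_iff, botE_prod, hM.at_iff, hN.at_iff]
  simp only [subE_prod, Prod.forall, Prod.mk.injEq, ne_eq]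
  constructor
  · rintro ⟨h, h'⟩
    by_cases ha : a = botE M
    · refine Or.inr ⟨ha, fun hb => h ⟨ha, hb⟩, fun c hc => ?_⟩
      rcases h' a c ⟨hM.refl a, hc⟩ with h₁ | h₁
      exacts [Or.inl h₁.2, Or.inr h₁.2]
    · have hb : b = botE N := by
        rcases h' a (botE N) ⟨hM.refl a, hN.bot_le b⟩ with h₁ | h₁
        exacts [absurd h₁.1 ha, h₁.2.symm]
      refine Or.inl ⟨⟨ha, fun c hc => ?_⟩, hb⟩
      rcases h' c b ⟨hc, hN.refl b⟩ with h₁ | h₁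
      exacts [Or.inl h₁.1, Or.inr h₁.1]
  · rintro (⟨⟨ha, h⟩, rfl⟩ | ⟨rfl, hb, h⟩)
    · refine ⟨fun h₁ => ha h₁.1, fun c d hcd => ?_⟩
      have := hN.le_bot_iff.1 hcd.2
      exact (h c hcd.1).imp (⟨·, this⟩) (⟨·, this⟩)
    · refine ⟨fun h₁ => hb h₁.2, fun c d hcd => ?_⟩
      have := hM.le_bot_iff.1 hcd.1
      exact (h d hcd.2).imp (⟨this, ·⟩) (⟨this, ·⟩)

theorem rectangular_realize (hM : IsBaseModel M) (hN : IsBaseModel N) {n : ℕ}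
    (φ : Lmso.BoundedFormula Empty n) :
    Rectangular M N fun xs : Fin n → M × N => φ.Realize default xs := by
  induction φ with
  | falsum => exact (Rectangular.left ⊥).congr fun xs => Iff.rfl
  | equal s t =>
    refine (Rectangular.prod (s.bdEqual t) (s.bdEqual t)).congr fun xs => ?_
    rw [BoundedFormula.realize_bdEqual, BoundedFormula.realize_bdEqual, ← term_realize_fst,
      ← term_realize_fst, ← term_realize_snd, ← term_realize_snd]
    exact Prod.ext_iff
  | @rel k l R ts =>
    match l, R with
    | 0, R => exact R.elim
    | 1, R =>
      refine (Rectangular.prod (atR.boundedFormula₁ (ts 0)) ((ts 0).bdEqual tb)).or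
        (Rectangular.prod ((ts 0).bdEqual tb) (atR.boundedFormula₁ (ts 0))) |>.congr fun xs => ?_
      have : (BoundedFormula.rel R ts).Realize default xs ↔
          atE ((ts 0).realize (Sum.elim default xs)) := by
        refine iff_of_eq (congrArg (Structure.RelMap atR) (funext fun i => ?_))
        rw [Subsingleton.elim i 0]
        rfl
      rw [this, atE_prod hM hN, term_realize_fst, term_realize_snd]
      simp [realize_tb, atE]
    | 2, true =>
      refine (Rectangular.prod (subR.boundedFormula₂ (ts 0) (ts 1))
        (subR.boundedFormula₂ (ts 0) (ts 1))).congr fun xs => ?_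
      simp only [BoundedFormula.realize_rel₂, ← term_realize_fst, ← term_realize_snd]
      exact Iff.rfl
    | 2, false =>
      refine (Rectangular.prod (∼((ts 0).bdEqual tb)) (∼((ts 1).bdEqual tb))).or
        ((Rectangular.left (exleR.boundedFormula₂ (ts 0) (ts 1))).or
        (Rectangular.right (exleR.boundedFormula₂ (ts 0) (ts 1)))) |>.congr fun xs => ?_
      simp only [BoundedFormula.realize_rel₂, BoundedFormula.realize_not,
        BoundedFormula.realize_bdEqual, realize_tb, ← term_realize_fst, ← term_realize_snd]
      exact Iff.rfl
    | l + 3, R => exact R.elim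
  | imp _ _ h₁ h₂ => exact h₁.imp h₂
  | all _ h => exact h.all

lemma Rectangular.exists_formula_fst {n : ℕ} {P : (Fin (n + 1) → M × N) → Prop}
    (hP : Rectangular M N P) (ys : Fin n → M × N) (b : N) :
    ∃ γ : BF (n + 1), ∀ a : M, P (Fin.snoc ys (a, b)) ↔
      γ.Realize default (Fin.snoc (fun i => (ys i).1) a) := by
  induction hP with
  | prod α β =>
    simp only [fst_snoc, snd_snoc]
    by_cases h : β.Realize default (Fin.snoc (fun i => (ys i).2) b)
    · exact ⟨α, fun a => and_iff_left h⟩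
    · exact ⟨⊥, fun a => by simp [h]⟩
  | or _ _ h₁ h₂ =>
    obtain ⟨γ, hγ⟩ := h₁
    obtain ⟨δ, hδ⟩ := h₂
    exact ⟨γ ⊔ δ, fun a => by simp [hγ, hδ]⟩

lemma Rectangular.exists_formula_snd {n : ℕ} {P : (Fin (n + 1) → M × N) → Prop}
    (hP : Rectangular M N P) (ys : Fin n → M × N) (a : M) :
    ∃ γ : BF (n + 1), ∀ b : N, P (Fin.snoc ys (a, b)) ↔
      γ.Realize default (Fin.snoc (fun i => (ys i).2) b) := by
  induction hP with
  | prod α β =>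
    simp only [fst_snoc, snd_snoc]
    by_cases h : α.Realize default (Fin.snoc (fun i => (ys i).1) a)
    · exact ⟨β, fun b => and_iff_right h⟩
    · exact ⟨⊥, fun b => by simp [h]⟩
  | or _ _ h₁ h₂ =>
    obtain ⟨γ, hγ⟩ := h₁
    obtain ⟨δ, hδ⟩ := h₂
    exact ⟨γ ⊔ δ, fun b => by simp [hγ, hδ]⟩

theorem comprehension_prod (hM : IsBaseModel M) (hN : IsBaseModel N) :
    Comprehension (M × N) := by
  intro n η ys
  have hη := rectangular_realize hM hN η
  obtain ⟨γ, hγ⟩ := hη.exists_formula_fst ys (botE N)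
  obtain ⟨δ, hδ⟩ := hη.exists_formula_snd ys (botE M)
  obtain ⟨X, hX⟩ := hM.comprehension n γ fun i => (ys i).1
  obtain ⟨Y, hY⟩ := hN.comprehension n δ fun i => (ys i).2
  refine ⟨(X, Y), ?_⟩
  rintro ⟨a, b⟩ hab
  rw [subE_prod]
  rcases (atE_prod hM hN _).1 hab with ⟨ha, rfl : b = _⟩ | ⟨rfl : a = _, hb⟩
  · rw [hγ, ← hX a ha]
    exact and_iff_left (hN.bot_le Y)
  · rw [hδ, ← hY b hb]
    exact and_iff_right (hM.bot_le X)

lemma isMeetE_prod (hM : IsBaseModel M) (hN : IsBaseModel N) {k i j : M × N} :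
    IsMeetE k i j ↔ IsMeetE k.1 i.1 j.1 ∧ IsMeetE k.2 i.2 j.2 := by
  constructor
  · rintro ⟨⟨h₁, h₂⟩, h⟩
    exact ⟨⟨⟨h₁.1, h₂.1⟩, fun d hi hj => (h (d, botE N) ⟨hi, hN.bot_le _⟩ ⟨hj, hN.bot_le _⟩).1⟩,
      ⟨⟨h₁.2, h₂.2⟩, fun d hi hj => (h (botE M, d) ⟨hM.bot_le _, hi⟩ ⟨hM.bot_le _, hj⟩).2⟩⟩
  · rintro ⟨⟨⟨h₁, h₂⟩, h⟩, ⟨⟨h₁', h₂'⟩, h'⟩⟩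
    exact ⟨⟨⟨h₁, h₁'⟩, ⟨h₂, h₂'⟩⟩, fun d hi hj => ⟨h _ hi.1 hj.1, h' _ hi.2 hj.2⟩⟩

lemma isJoinE_prod (hM : IsBaseModel M) (hN : IsBaseModel N) {k i j : M × N} :
    IsJoinE k i j ↔ IsJoinE k.1 i.1 j.1 ∧ IsJoinE k.2 i.2 j.2 := by
  obtain ⟨s, hs⟩ := hM.top
  obtain ⟨t, ht⟩ := hN.top
  constructor
  · rintro ⟨⟨h₁, h₂⟩, h⟩
    exact ⟨⟨⟨h₁.1, h₂.1⟩, fun d hi hj => (h (d, t) ⟨hi, ht _⟩ ⟨hj, ht _⟩).1⟩,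
      ⟨⟨h₁.2, h₂.2⟩, fun d hi hj => (h (s, d) ⟨hs _, hi⟩ ⟨hs _, hj⟩).2⟩⟩
  · rintro ⟨⟨⟨h₁, h₂⟩, h⟩, ⟨⟨h₁', h₂'⟩, h'⟩⟩
    exact ⟨⟨⟨h₁, h₁'⟩, ⟨h₂, h₂'⟩⟩, fun d hi hj => ⟨h _ hi.1 hj.1, h' _ hi.2 hj.2⟩⟩

lemma atE_left (hM : IsBaseModel M) (hN : IsBaseModel N) {a : M} :
    atE ((a, botE N) : M × N) ↔ atE a := by
  simp [atE_prod hM hN, hN.not_at_bot]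

lemma atE_right (hM : IsBaseModel M) (hN : IsBaseModel N) {b : N} :
    atE ((botE M, b) : M × N) ↔ atE b := by
  simp [atE_prod hM hN, hM.not_at_bot]

lemma exleE_left_left (hN : IsBaseModel N) {a a' : M} :
    exleE ((a, botE N) : M × N) (a', botE N) ↔ exleE a a' := by
  simp [exleE_prod, hN.not_exle_bot_left]

lemma exleE_right_right (hM : IsBaseModel M) {b b' : N} :
    exleE ((botE M, b) : M × N) (botE M, b') ↔ exleE b b' := by
  simp [exleE_prod, hM.not_exle_bot_left]

lemma exleE_left_right (hM : IsBaseModel M) (hN : IsBaseModel N) {a : M} {b : N}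
    (ha : atE a) (hb : atE b) : exleE ((a, botE N) : M × N) (botE M, b) := by
  simp [exleE_prod, hM.at_ne_bot ha, hN.at_ne_bot hb]

lemma not_exleE_right_left (hM : IsBaseModel M) (hN : IsBaseModel N) {a : M} {b : N} :
    ¬ exleE ((botE M, b) : M × N) (a, botE N) := by
  simp [exleE_prod, hM.not_exle_bot_left, hN.not_exle_bot_right]

lemma exists_atE_prod (hM : IsBaseModel M) (hN : IsBaseModel N) {P : M × N → Prop} :
    (∃ p, atE p ∧ P p) ↔
      (∃ a, atE a ∧ P (a, botE N)) ∨ ∃ b, atE b ∧ P (botE M, b) := by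
  constructor
  · rintro ⟨⟨a, b⟩, hp, h⟩
    rcases (atE_prod hM hN _).1 hp with ⟨ha, rfl : b = _⟩ | ⟨rfl : a = _, hb⟩
    exacts [Or.inl ⟨a, ha, h⟩, Or.inr ⟨b, hb, h⟩]
  · rintro (⟨a, ha, h⟩ | ⟨b, hb, h⟩)
    exacts [⟨_, (atE_left hM hN).2 ha, h⟩, ⟨_, (atE_right hM hN).2 hb, h⟩]

lemma forall_atE_prod (hM : IsBaseModel M) (hN : IsBaseModel N) {P : M × N → Prop} :
    (∀ p, atE p → P p) ↔
      (∀ a, atE a → P (a, botE N)) ∧ ∀ b, atE b → P (botE M, b) := by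
  constructor
  · exact fun h => ⟨fun a ha => h _ ((atE_left hM hN).2 ha),
      fun b hb => h _ ((atE_right hM hN).2 hb)⟩
  · rintro ⟨h, h'⟩ ⟨a, b⟩ hp
    rcases (atE_prod hM hN _).1 hp with ⟨ha, rfl : b = _⟩ | ⟨rfl : a = _, hb⟩
    exacts [h a ha, h' b hb]

theorem IsBaseModel.prod (hM : IsBaseModel M) (hN : IsBaseModel N) : IsBaseModel (M × N) where
  refl a := ⟨hM.refl _, hN.refl _⟩
  antisymm a b h h' := Prod.ext (hM.antisymm _ _ h.1 h'.1) (hN.antisymm _ _ h.2 h'.2)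
  trans a b c h h' := ⟨hM.trans _ _ _ h.1 h'.1, hN.trans _ _ _ h.2 h'.2⟩
  bot_le a := ⟨hM.bot_le _, hN.bot_le _⟩
  top := by
    obtain ⟨s, hs⟩ := hM.top
    obtain ⟨t, ht⟩ := hN.top
    exact ⟨(s, t), fun a => ⟨hs _, ht _⟩⟩
  meet a b := by
    obtain ⟨s, hs⟩ := hM.meet a.1 b.1
    obtain ⟨t, ht⟩ := hN.meet a.2 b.2
    exact ⟨(s, t), (isMeetE_prod hM hN).2 ⟨hs, ht⟩⟩
  join a b := by
    obtain ⟨s, hs⟩ := hM.join a.1 b.1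
    obtain ⟨t, ht⟩ := hN.join a.2 b.2
    exact ⟨(s, t), (isJoinE_prod hM hN).2 ⟨hs, ht⟩⟩
  compl a := by
    obtain ⟨s, hs, hs'⟩ := hM.compl a.1
    obtain ⟨t, ht, ht'⟩ := hN.compl a.2
    exact ⟨(s, t), fun d h h' => Prod.ext (hs _ h.1 h'.1) (ht _ h.2 h'.2),
      fun d h h' e => ⟨hs' _ h.1 h'.1 _, ht' _ h.2 h'.2 _⟩⟩
  distrib a b c d e f g h := by
    simp only [isMeetE_prod hM hN, isJoinE_prod hM hN]
    exact fun h₁ h₂ h₃ h₄ h₅ => ⟨hM.distrib _ _ _ _ _ _ _ _ h₁.1 h₂.1 h₃.1 h₄.1 h₅.1,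
      hN.distrib _ _ _ _ _ _ _ _ h₁.2 h₂.2 h₃.2 h₄.2 h₅.2⟩
  at_iff a := atE_prod_iff
  atomic := by
    rintro ⟨a, b⟩ hab
    rw [exists_atE_prod hM hN]
    by_cases ha : a = botE M
    · have hb : b ≠ botE N := fun hb => hab (Prod.ext ha hb)
      obtain ⟨c, hc, hcb⟩ := hN.atomic b hb
      exact Or.inr ⟨c, hc, hM.bot_le _, hcb⟩
    · obtain ⟨c, hc, hca⟩ := hM.atomic a ha
      exact Or.inl ⟨c, hc, hca, hN.bot_le _⟩
  irrefl := by
    rw [forall_atE_prod hM hN]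
    simp only [exleE_left_left hN, exleE_right_right hM]
    exact ⟨hM.irrefl, hN.irrefl⟩
  trans_at := by
    suffices h : ∀ a : M × N, atE a → ∀ b : M × N, atE b → ∀ c : M × N, atE c →
        exleE a b → exleE b c → exleE a c from fun a b c ha hb hc => h a ha b hb c hc
    simp only [forall_atE_prod hM hN, exleE_left_left hN, exleE_right_right hM,
      not_exleE_right_left hM hN]
    refine ⟨fun a ha => ⟨fun b hb => ⟨fun c hc => hM.trans_at a b c ha hb hc,
      fun c hc _ _ => exleE_left_right hM hN ha hc⟩, fun b hb => ⟨fun c hc _ h => h.elim,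
      fun c hc _ _ => exleE_left_right hM hN ha hc⟩⟩, fun a ha => ⟨fun b hb => ⟨fun c hc h => h.elim,
      fun c hc h => h.elim⟩, fun b hb => ⟨fun c hc _ h => h,
      fun c hc => hN.trans_at a b c ha hb hc⟩⟩⟩
  trich := by
    suffices h : ∀ a : M × N, atE a → ∀ b : M × N, atE b →
        (exleE a b ∨ a = b) ∨ exleE b a from fun a b ha hb => h a ha b hb
    simp only [forall_atE_prod hM hN, exleE_left_left hN, exleE_right_right hM, Prod.mk.injEq,
      and_true, true_and]
    exact ⟨fun a ha => ⟨fun b hb => hM.trich a b ha hb,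
      fun b hb => Or.inl (Or.inl (exleE_left_right hM hN ha hb))⟩,
      fun a ha => ⟨fun b hb => Or.inr (exleE_left_right hM hN hb ha),
      fun b hb => hN.trich a b ha hb⟩⟩
  exle_iff := by
    rintro ⟨a, b⟩ ⟨c, d⟩
    rw [exleE_prod]
    constructor
    · rintro (⟨ha, hd⟩ | h | h)
      · obtain ⟨x, hx, hxa⟩ := hM.atomic a ha
        obtain ⟨y, hy, hyd⟩ := hN.atomic d hd
        exact ⟨(x, botE N), (botE M, y), ⟨⟨⟨(atE_left hM hN).2 hx, (atE_right hM hN).2 hy⟩,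
          hxa, hN.bot_le _⟩, hM.bot_le _, hyd⟩, exleE_left_right hM hN hx hy⟩
      · obtain ⟨x, y, ⟨⟨⟨hx, hy⟩, hxa⟩, hyc⟩, hxy⟩ := (hM.exle_iff _ _).1 h
        exact ⟨(x, botE N), (y, botE N), ⟨⟨⟨(atE_left hM hN).2 hx, (atE_left hM hN).2 hy⟩,
          hxa, hN.bot_le _⟩, hyc, hN.bot_le _⟩, (exleE_left_left hN).2 hxy⟩
      · obtain ⟨x, y, ⟨⟨⟨hx, hy⟩, hxa⟩, hyc⟩, hxy⟩ := (hN.exle_iff _ _).1 h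
        exact ⟨(botE M, x), (botE M, y), ⟨⟨⟨(atE_right hM hN).2 hx, (atE_right hM hN).2 hy⟩,
          hM.bot_le _, hxa⟩, hM.bot_le _, hyc⟩, (exleE_right_right hM).2 hxy⟩
    · rintro ⟨⟨x, x'⟩, ⟨y, y'⟩, ⟨⟨⟨hx, hy⟩, hxa⟩, hyc⟩, hxy⟩
      rcases (atE_prod hM hN _).1 hx with ⟨hx, rfl : x' = _⟩ | ⟨rfl : x = _, hx⟩ <;>
        rcases (atE_prod hM hN _).1 hy with ⟨hy, rfl : y' = _⟩ | ⟨rfl : y = _, hy⟩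
      · exact Or.inr (Or.inl ((hM.exle_iff _ _).2
          ⟨x, y, ⟨⟨⟨hx, hy⟩, hxa.1⟩, hyc.1⟩, (exleE_left_left hN).1 hxy⟩))
      · refine Or.inl ⟨?_, ?_⟩
        · rintro rfl
          exact hM.at_ne_bot hx (hM.le_bot_iff.1 hxa.1)
        · rintro rfl
          exact hN.at_ne_bot hy (hN.le_bot_iff.1 hyc.2)
      · exact absurd hxy (not_exleE_right_left hM hN)
      · exact Or.inr (Or.inr ((hN.exle_iff _ _).2
          ⟨x', y', ⟨⟨⟨hx, hy⟩, hxa.2⟩, hyc.2⟩, (exleE_right_right hM).1 hxy⟩))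
  comprehension := comprehension_prod hM hN

lemma isSuccE_left (hM : IsBaseModel M) (hN : IsBaseModel N) {a a' : M} (h : IsSuccE a' a) :
    IsSuccE ((a', botE N) : M × N) (a, botE N) := by
  obtain ⟨⟨⟨ha, ha'⟩, haa'⟩, h⟩ := h
  refine ⟨⟨⟨(atE_left hM hN).2 ha, (atE_left hM hN).2 ha'⟩, (exleE_left_left hN).2 haa'⟩, ?_⟩
  rw [forall_atE_prod hM hN]
  simp only [exleE_left_left hN, Prod.mk.injEq, and_true]
  exact ⟨h, fun b hb _ => Or.inr (exleE_left_right hM hN ha' hb)⟩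

lemma isSuccE_right (hM : IsBaseModel M) (hN : IsBaseModel N) {b b' : N} (h : IsSuccE b' b) :
    IsSuccE ((botE M, b') : M × N) (botE M, b) := by
  obtain ⟨⟨⟨hb, hb'⟩, hbb'⟩, h⟩ := h
  refine ⟨⟨⟨(atE_right hM hN).2 hb, (atE_right hM hN).2 hb'⟩, (exleE_right_right hM).2 hbb'⟩, ?_⟩
  rw [forall_atE_prod hM hN]
  simp only [exleE_right_right hM, Prod.mk.injEq, true_and]
  exact ⟨fun a _ hba => absurd hba (not_exleE_right_left hM hN), h⟩

lemma isSuccE_left_right (hM : IsBaseModel M) (hN : IsBaseModel N) {a : M} {b : N}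
    (ha : atE a) (ha' : ∀ c, atE c → ¬ exleE a c) (hb : atE b)
    (hb' : ∀ c, atE c → ¬ exleE c b) : IsSuccE ((botE M, b) : M × N) (a, botE N) := by
  refine ⟨⟨⟨(atE_left hM hN).2 ha, (atE_right hM hN).2 hb⟩, exleE_left_right hM hN ha hb⟩, ?_⟩
  rw [forall_atE_prod hM hN]
  simp only [exleE_left_left hN, exleE_right_right hM, Prod.mk.injEq, true_and]
  refine ⟨fun c hc hac => absurd hac (ha' c hc), fun c hc _ => ?_⟩
  rcases hN.trich c b hc hb with (h | h) | h
  exacts [absurd h (hb' c hc), Or.inl h, Or.inr h]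

theorem IsFinModel.prod (hM : IsFinModel M) (hN : IsFinModel N) : IsFinModel (M × N) where
  toIsBaseModel := hM.toIsBaseModel.prod hN.toIsBaseModel
  least := by
    have hM' := hM.toIsBaseModel
    have hN' := hN.toIsBaseModel
    by_cases h : ∃ a : M, atE a
    · obtain ⟨a, ha⟩ := h
      obtain ⟨b, hb, hb'⟩ := hM.least a ha
      refine fun _ _ => ⟨(b, botE N), (atE_left hM' hN').2 hb, ?_⟩
      simp only [forall_atE_prod hM' hN', exleE_left_left hN']
      exact ⟨hb', fun _ _ => not_exleE_right_left hM' hN'⟩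
    · have h' : ∀ a : M, ¬ atE a := not_exists.1 h
      rw [forall_atE_prod hM' hN']
      refine ⟨fun a ha => absurd ha (h' a), fun b hb => ?_⟩
      obtain ⟨c, hc, hc'⟩ := hN.least b hb
      refine ⟨(botE M, c), (atE_right hM' hN').2 hc, ?_⟩
      simp only [forall_atE_prod hM' hN', exleE_right_right hM']
      exact ⟨fun a ha => absurd ha (h' a), hc'⟩
  greatest := by
    have hM' := hM.toIsBaseModel
    have hN' := hN.toIsBaseModel
    by_cases h : ∃ b : N, atE b
    · obtain ⟨b, hb⟩ := h
      obtain ⟨c, hc, hc'⟩ := hN.greatest b hb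
      refine fun _ _ => ⟨(botE M, c), (atE_right hM' hN').2 hc, ?_⟩
      simp only [forall_atE_prod hM' hN', exleE_right_right hM']
      exact ⟨fun _ _ => not_exleE_right_left hM' hN', hc'⟩
    · have h' : ∀ b : N, ¬ atE b := not_exists.1 h
      rw [forall_atE_prod hM' hN']
      refine ⟨fun a ha => ?_, fun b hb => absurd hb (h' b)⟩
      obtain ⟨c, hc, hc'⟩ := hM.greatest a ha
      refine ⟨(c, botE N), (atE_left hM' hN').2 hc, ?_⟩
      simp only [forall_atE_prod hM' hN', exleE_left_left hN']
      exact ⟨hc', fun b hb => absurd hb (h' b)⟩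
  succ := by
    have hM' := hM.toIsBaseModel
    have hN' := hN.toIsBaseModel
    suffices h : ∀ a : M × N, atE a → ∀ b : M × N, atE b → exleE a b → ∃ c, IsSuccE c a from
      fun a b ha hb => h a ha b hb
    simp only [forall_atE_prod hM' hN', exleE_left_left hN', exleE_right_right hM',
      not_exleE_right_left hM' hN']
    have left : ∀ a : M, atE a → ∀ a', atE a' → exleE a a' →
        ∃ c, IsSuccE c ((a, botE N) : M × N) := fun a ha a' ha' haa' => by
      obtain ⟨c, hc⟩ := hM.succ a a' ha ha' haa'
      exact ⟨_, isSuccE_left hM' hN' hc⟩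
    refine ⟨fun a ha => ⟨left a ha, fun b hb _ => ?_⟩,
      fun b hb => ⟨fun a ha h => h.elim, fun b' hb' hbb' => ?_⟩⟩
    · by_cases h : ∃ a', atE a' ∧ exleE a a'
      · obtain ⟨a', ha', haa'⟩ := h
        exact left a ha a' ha' haa'
      · obtain ⟨c, hc, hc'⟩ := hN.least b hb
        exact ⟨_, isSuccE_left_right hM' hN' ha (fun d hd had => h ⟨d, hd, had⟩) hc hc'⟩
    · obtain ⟨c, hc⟩ := hN.succ b b' hb hb' hbb'
      exact ⟨_, isSuccE_right hM' hN' hc⟩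
  pred := by
    have hM' := hM.toIsBaseModel
    have hN' := hN.toIsBaseModel
    suffices h : ∀ a : M × N, atE a → ∀ b : M × N, atE b → exleE b a → ∃ c, IsSuccE a c from
      fun a b ha hb => h a ha b hb
    simp only [forall_atE_prod hM' hN', exleE_left_left hN', exleE_right_right hM',
      not_exleE_right_left hM' hN']
    have right : ∀ b : N, atE b → ∀ b', atE b' → exleE b' b →
        ∃ c, IsSuccE ((botE M, b) : M × N) c := fun b hb b' hb' hbb' => by
      obtain ⟨c, hc⟩ := hN.pred b b' hb hb' hbb'
      exact ⟨_, isSuccE_right hM' hN' hc⟩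
    refine ⟨fun a ha => ⟨fun a' ha' haa' => ?_, fun b hb h => h.elim⟩,
      fun b hb => ⟨fun a ha _ => ?_, right b hb⟩⟩
    · obtain ⟨c, hc⟩ := hM.pred a a' ha ha' haa'
      exact ⟨_, isSuccE_left hM' hN' hc⟩
    · by_cases h : ∃ b', atE b' ∧ exleE b' b
      · obtain ⟨b', hb', hbb'⟩ := h
        exact right b hb b' hb' hbb'
      · obtain ⟨c, hc, hc'⟩ := hM.greatest a ha
        exact ⟨_, isSuccE_left_right hM' hN' hc hc' hb fun d hd hdb => h ⟨d, hd, hdb⟩⟩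
  least_in := by
    have hM' := hM.toIsBaseModel
    have hN' := hN.toIsBaseModel
    rintro ⟨a, b⟩ hab
    simp only [and_assoc, forall_atE_prod hM' hN', exists_atE_prod hM' hN', exleE_left_left hN',
      exleE_right_right hM', subE_prod]
    by_cases ha : a = botE M
    · have hb : b ≠ botE N := fun hb => hab (Prod.ext ha hb)
      obtain ⟨c, ⟨hc, hcb⟩, h⟩ := hN.least_in b hb
      refine Or.inr ⟨c, hc, hM'.bot_le _, hcb, fun d hd hda => ?_, fun d hd hdb => h d hd hdb.2⟩
      exact absurd (hM'.le_bot_iff.1 (ha ▸ hda.1)) (hM'.at_ne_bot hd)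
    · obtain ⟨c, ⟨hc, hca⟩, h⟩ := hM.least_in a ha
      exact Or.inl ⟨c, hc, hca, hN'.bot_le _, fun d hd hda => h d hd hda.1,
        fun d _ _ => not_exleE_right_left hM' hN'⟩

end Product

theorem statement8 (M N : Type) [Lmso.Structure M] [Lmso.Structure N]
    (hM : M ⊨ TMSOFin) (hN : N ⊨ TMSOFin) : (M × N) ⊨ TMSOFin :=
  model_TMSOFin_iff.2 ((model_TMSOFin_iff.1 hM).prod (model_TMSOFin_iff.1 hN))

end MSO
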